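/- For every ε with 0 ≤ ε < 1, every a with 0 < a < ∞, and every general source X, the infimum (ε,a)-achievable second-order overflow threshold satisfies L(ε,a|X) = inf{ L : F_a(L) ≤ ε }, where F_a(L) = limsup_{n→∞} Pr{ (−log_K P_{X^n}(X^n) − n α_c a) / (√n · α_c) ≥ L }. -/

import Mathlib

open scoped BigOperators

/-- Cost of a string `l` over the code alphabet `Fin K`: the sum of the conditional
per-symbol costs `c (l.get i) (prefix before position i)`. -/
noncomputable def strCost {K : ℕ} (c : Fin K → List (Fin K) → ℝ) (l : List (Fin K)) : ℝ :=
  ∑ i : Fin l.length, c (l.get i) (l.take i.val)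

/-- Probability of the set `S` under the probability mass function `P`. -/
noncomputable def prSet {α : Type*} (P : α → ℝ) (S : Set α) : ℝ :=
  ∑' x, S.indicator P x

/-- Two sets of reals each of which contains all positive translates of the other have the same
infimum. -/
theorem sInf_eq_of_forall_add_mem {A B : Set ℝ}
    (hAB : ∀ L ∈ A, ∀ γ > 0, L + γ ∈ B) (hBA : ∀ L ∈ B, ∀ γ > 0, L + γ ∈ A) :
    sInf A = sInf B := by
  have key : ∀ {S T : Set ℝ}, (∀ L ∈ S, ∀ γ > 0, L + γ ∈ T) →
      lowerBounds T ⊆ lowerBounds S := fun h m hm b hb =>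
    le_of_forall_pos_le_add fun γ hγ => hm (h b hb γ hγ)
  have hlb : lowerBounds A = lowerBounds B := (key hBA).antisymm (key hAB)
  rcases A.eq_empty_or_nonempty with rfl | hA
  · rcases B.eq_empty_or_nonempty with rfl | ⟨b, hb⟩
    · rfl
    · exact absurd (hBA b hb 1 one_pos) (Set.notMem_empty _)
  · have hB : B.Nonempty := hA.elim fun b hb => ⟨_, hAB b hb 1 one_pos⟩
    by_cases hbd : BddBelow A
    · have hbd' : BddBelow B := by rwa [BddBelow, ← hlb]
      have h := isGLB_csInf hA hbd
      rw [IsGLB, hlb] at h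
      exact IsGreatest.unique h (isGLB_csInf hB hbd')
    · have hbd' : ¬ BddBelow B := by rwa [BddBelow, ← hlb]
      rw [Real.sInf_of_not_bddBelow hbd, Real.sInf_of_not_bddBelow hbd']

theorem prSet_nonneg {α : Type*} {P : α → ℝ} (hP : ∀ x, 0 ≤ P x) (S : Set α) :
    0 ≤ prSet P S :=
  tsum_nonneg fun x => Set.indicator_nonneg (fun x _ => hP x) x

theorem prSet_mono {α : Type*} {P : α → ℝ} (hP : ∀ x, 0 ≤ P x) (hs : Summable P)
    {S T : Set α} (h : ∀ x ∈ S, 0 < P x → x ∈ T) : prSet P S ≤ prSet P T := by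
  refine (hs.indicator S).tsum_le_tsum (fun x => ?_) (hs.indicator T)
  by_cases hx : x ∈ S
  · rcases (hP x).eq_or_lt with h0 | h0
    · rw [Set.indicator_of_mem hx, ← h0]
      exact Set.indicator_nonneg (fun x _ => hP x) x
    · simp [hx, h x hx h0]
  · simpa [hx] using Set.indicator_nonneg (fun x _ => hP x) x

theorem prSet_le_one {α : Type*} {P : α → ℝ} (hP : ∀ x, 0 ≤ P x) (hs : HasSum P 1)
    (S : Set α) : prSet P S ≤ 1 := by
  rw [← hs.tsum_eq]
  exact (hs.summable.indicator S).tsum_le_tsum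
    (fun x => Set.indicator_le_self' (fun _ _ => hP _) x) hs.summable

/-- If `limsup u ≤ ε` and `v` is eventually at most `u` plus a null sequence,
then `limsup v ≤ ε`. -/
theorem limsup_le_of_eventually_le_add {u v w : ℕ → ℝ} {ε : ℝ}
    (hu1 : ∀ n, u n ≤ 1) (hv0 : ∀ n, 0 ≤ v n)
    (hw : Filter.Tendsto w Filter.atTop (nhds 0))
    (h : ∀ᶠ n in Filter.atTop, v n ≤ u n + w n)
    (hu : Filter.limsup u Filter.atTop ≤ ε) : Filter.limsup v Filter.atTop ≤ ε := by
  refine le_of_forall_pos_le_add fun η hη => ?_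
  have hu' : ∀ᶠ n in Filter.atTop, u n < ε + η / 2 :=
    Filter.eventually_lt_of_limsup_lt (by linarith)
      (Filter.isBoundedUnder_of ⟨1, hu1⟩)
  have hw' : ∀ᶠ n in Filter.atTop, w n < η / 2 := hw.eventually_lt_const (by linarith)
  refine Filter.limsup_le_of_le ?_ ?_
  · exact (Filter.isBoundedUnder_of ⟨0, hv0⟩ :
      Filter.IsBoundedUnder (· ≥ ·) Filter.atTop v).isCoboundedUnder_le
  · filter_upwards [hu', hw', h] with n h1 h2 h3
    linarith

theorem strCost_replicate {K : ℕ} (c : Fin K → List (Fin K) → ℝ) (u : Fin K) (k : ℕ) :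
    strCost c (List.replicate k u) = ∑ i ∈ Finset.range k, c u (List.replicate i u) := by
  have h : strCost c (List.replicate k u)
      = ∑ i : Fin (List.replicate k u).length, c u (List.replicate i.val u) := by
    refine Finset.sum_congr rfl fun i _ => ?_
    have hi : i.val ≤ k := by simpa using i.isLt.le
    simp [List.take_replicate, hi]
  rw [h, Fin.sum_univ_eq_sum_range (fun i => c u (List.replicate i u)), List.length_replicate]

/-- Bounded symbol costs with a cost capacity are bounded away from zero. -/
theorem exists_pos_le_cost {K : ℕ} (hK : 2 ≤ K) {c : Fin K → List (Fin K) → ℝ} {cmax αc : ℝ}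
    (hcmax : ∀ u s, c u s ≤ cmax) (hαc : 0 < αc)
    (hcap : ∀ s : List (Fin K), ∑ u : Fin K, (K : ℝ) ^ (-(αc * c u s)) = 1) :
    ∃ δ > 0, ∀ u s, δ ≤ c u s := by
  have hK1 : (1 : ℝ) < K := by exact_mod_cast hK
  have hK0 : (0 : ℝ) < K := by linarith
  set b : ℝ := (K : ℝ) ^ (-(αc * cmax)) with hb
  have hb0 : 0 < b := Real.rpow_pos_of_pos hK0 _
  have hle : ∀ u s, (K : ℝ) ^ (-(αc * c u s)) ≤ 1 - b := by
    intro u s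
    have : Nontrivial (Fin K) := Fin.nontrivial_iff_two_le.2 hK
    obtain ⟨v, hv⟩ := exists_ne u
    have h1 : ∑ w ∈ ({u, v} : Finset (Fin K)), (K : ℝ) ^ (-(αc * c w s)) ≤ 1 := by
      rw [← hcap s]
      exact Finset.sum_le_sum_of_subset_of_nonneg (Finset.subset_univ _)
        fun _ _ _ => (Real.rpow_pos_of_pos hK0 _).le
    rw [Finset.sum_pair hv.symm] at h1
    have h2 : b ≤ (K : ℝ) ^ (-(αc * c v s)) :=
      Real.rpow_le_rpow_of_exponent_le hK1.le
        (neg_le_neg (mul_le_mul_of_nonneg_left (hcmax v s) hαc.le))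
    linarith
  have hb1 : 0 < 1 - b :=
    (Real.rpow_pos_of_pos hK0 _).trans_le (hle ⟨0, by omega⟩ [])
  refine ⟨-Real.logb K (1 - b) / αc, div_pos (neg_pos.2
    (Real.logb_neg hK1 hb1 (by linarith))) hαc, fun u s => ?_⟩
  have h := (Real.le_logb_iff_rpow_le hK1 hb1).2 (hle u s)
  rw [div_le_iff₀ hαc]
  linarith

/-- Every nonnegative target cost is exceeded by at most `cmax` by some nonempty string. -/
theorem exists_strCost_mem_Icc {K : ℕ} (hK : 2 ≤ K) {c : Fin K → List (Fin K) → ℝ}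
    {cmax αc : ℝ} (hcmax : ∀ u s, c u s ≤ cmax) (hαc : 0 < αc)
    (hcap : ∀ s : List (Fin K), ∑ u : Fin K, (K : ℝ) ^ (-(αc * c u s)) = 1)
    {t : ℝ} (ht : 0 ≤ t) :
    ∃ l : List (Fin K), l ≠ [] ∧ t ≤ strCost c l ∧ strCost c l ≤ t + cmax := by
  obtain ⟨δ, hδ, hc⟩ := exists_pos_le_cost hK hcmax hαc hcap
  let u : Fin K := ⟨0, by omega⟩
  have hex : ∃ k, t ≤ strCost c (List.replicate (k + 1) u) := by
    obtain ⟨k, hk⟩ := exists_nat_gt (t / δ)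
    refine ⟨k, ?_⟩
    rw [strCost_replicate]
    have h1 := Finset.card_nsmul_le_sum (Finset.range (k + 1))
      (fun i => c u (List.replicate i u)) δ fun i _ => hc _ _
    rw [div_lt_iff₀ hδ] at hk
    simp only [Finset.card_range, nsmul_eq_mul] at h1
    push_cast at h1
    linarith
  classical
  refine ⟨List.replicate (Nat.find hex + 1) u, by simp, Nat.find_spec hex, ?_⟩
  have hprev : strCost c (List.replicate (Nat.find hex) u) ≤ t := by
    rcases hk : Nat.find hex with _ | k
    · simpa [strCost] using ht
    · exact (not_le.1 (Nat.find_min hex (by omega : k < Nat.find hex))).le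
  rw [strCost_replicate, Finset.sum_range_succ, ← strCost_replicate]
  exact add_le_add hprev (hcmax _ _)

/-- For every probability mass function there is an encoder satisfying the cost Kraft inequality
whose cost exceeds the ideal cost by at most a constant. -/
theorem exists_encoder {K : ℕ} (hK : 2 ≤ K) {c : Fin K → List (Fin K) → ℝ}
    {cmax αc : ℝ} (hcmax : ∀ u s, c u s ≤ cmax) (hαc : 0 < αc)
    (hcap : ∀ s : List (Fin K), ∑ u : Fin K, (K : ℝ) ^ (-(αc * c u s)) = 1)
    {α : Type*} [Countable α] {p : α → ℝ} (hp : ∀ x, 0 ≤ p x) (hsum : HasSum p 1) :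
    ∃ φ : α → List (Fin K), (∀ x, φ x ≠ []) ∧
      (∑' x, ENNReal.ofReal ((K : ℝ) ^ (-(αc * strCost c (φ x)))) ≤ 1) ∧
      ∀ x, 0 < p x →
        αc * strCost c (φ x) ≤ -Real.logb K (p x) + (Real.logb K 2 + αc * cmax) := by
  have hK1 : (1 : ℝ) < K := by exact_mod_cast hK
  have hK0 : (0 : ℝ) < K := by linarith
  obtain ⟨w, hw, r, hwr, hr⟩ : ∃ w : α → ℝ, (∀ x, 0 < w x) ∧ ∃ r, HasSum w r ∧ r ≤ 1 := by
    cases nonempty_encodable α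
    obtain ⟨w, hw⟩ := posSumOfEncodable one_pos α
    exact ⟨w, hw⟩
  set q : α → ℝ := fun x => (p x + w x) / 2 with hq
  have hq0 : ∀ x, 0 < q x := fun x => half_pos (add_pos_of_nonneg_of_pos (hp x) (hw x))
  have hqs : HasSum q ((1 + r) / 2) := (hsum.add hwr).div_const 2
  have hq1 : ∀ x, q x ≤ 1 := fun x =>
    (le_hasSum hqs x fun y _ => (hq0 y).le).trans (by linarith)
  have ht : ∀ x, 0 ≤ -Real.logb K (q x) / αc := fun x =>
    div_nonneg (neg_nonneg.2 (Real.logb_nonpos hK1 (hq0 x).le (hq1 x))) hαc.le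
  choose φ hne hlo hhi using fun x => exists_strCost_mem_Icc hK hcmax hαc hcap (ht x)
  refine ⟨φ, hne, ?_, fun x hx => ?_⟩
  · calc ∑' x, ENNReal.ofReal ((K : ℝ) ^ (-(αc * strCost c (φ x))))
        ≤ ∑' x, ENNReal.ofReal (q x) := by
          refine ENNReal.tsum_le_tsum fun x => ENNReal.ofReal_le_ofReal ?_
          rw [← Real.le_logb_iff_rpow_le hK1 (hq0 x)]
          have h := hlo x
          rw [div_le_iff₀ hαc] at h
          linarith
      _ = ENNReal.ofReal ((1 + r) / 2) := by
          rw [← ENNReal.ofReal_tsum_of_nonneg (fun x => (hq0 x).le) hqs.summable, hqs.tsum_eq]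
      _ ≤ 1 := ENNReal.ofReal_le_one.2 (by linarith)
  · have h1 : Real.logb K (p x) - Real.logb K 2 ≤ Real.logb K (q x) := by
      rw [← Real.logb_div hx.ne' two_ne_zero]
      refine Real.logb_le_logb_of_le hK1 (half_pos hx) ?_
      have := (hw x).le
      simp only [hq]
      linarith
    have h2 := mul_le_mul_of_nonneg_left (hhi x) hαc.le
    rw [mul_add, mul_div_cancel₀ _ hαc.ne'] at h2
    linarith

/-- Converse bound: up to `K ^ (-d)`, the overflow probability of an encoder satisfying the Kraft
inequality dominates the probability that the self-information exceeds the (scaled) threshold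
by `d`. -/
theorem prSet_selfInformation_le {K : ℕ} (hK : 2 ≤ K) {α : Type*} {p : α → ℝ}
    (hp : ∀ x, 0 ≤ p x) (hsum : Summable p) {g : α → ℝ}
    (hg : ∑' x, ENNReal.ofReal ((K : ℝ) ^ (-g x)) ≤ 1) (T d : ℝ) :
    prSet p {x | T + d ≤ -Real.logb K (p x)} ≤
      prSet p {x | T < g x} + (K : ℝ) ^ (-d) := by
  have hK1 : (1 : ℝ) < K := by exact_mod_cast hK
  have hK0 : (0 : ℝ) < K := by linarith
  have hg0 : ∀ x, 0 ≤ (K : ℝ) ^ (-g x) := fun x => (Real.rpow_pos_of_pos hK0 _).le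
  have hfin : ∀ s : Finset α, ∑ x ∈ s, (K : ℝ) ^ (-g x) ≤ 1 := fun s => by
    rw [← ENNReal.ofReal_le_one, ENNReal.ofReal_sum_of_nonneg fun x _ => hg0 x]
    exact (ENNReal.sum_le_tsum s).trans hg
  have hgs : Summable fun x => (K : ℝ) ^ (-g x) := summable_of_sum_le hg0 hfin
  have hO := hsum.indicator {x | T < g x}
  have hd0 : 0 ≤ (K : ℝ) ^ (-d) := (Real.rpow_pos_of_pos hK0 _).le
  calc prSet p {x | T + d ≤ -Real.logb K (p x)}
      ≤ ∑' x, ({x | T < g x}.indicator p x + (K : ℝ) ^ (-d) * (K : ℝ) ^ (-g x)) := by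
        refine (hsum.indicator _).tsum_le_tsum (fun x => ?_) (hO.add (hgs.mul_left _))
        have h0 := mul_nonneg hd0 (hg0 x)
        by_cases hx : T + d ≤ -Real.logb K (p x)
        · by_cases hx' : T < g x
          · simpa [Set.indicator_apply, hx, hx'] using h0
          · rcases (hp x).eq_or_lt with hpx | hpx
            · simpa [Set.indicator_apply, ← hpx] using h0
            · have : p x ≤ (K : ℝ) ^ (-d) * (K : ℝ) ^ (-g x) := by
                rw [← Real.rpow_add hK0, ← Real.logb_le_iff_le_rpow hK1 hpx]
                linarith
              simpa [Set.indicator_apply, hx, hx'] using this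
        · have := Set.indicator_nonneg (s := {x | T < g x}) (fun x _ => hp x) x
          rw [Set.indicator_of_notMem (s := {x | T + d ≤ -Real.logb K (p x)}) hx]
          linarith
    _ = prSet p {x | T < g x} + (K : ℝ) ^ (-d) * ∑' x, (K : ℝ) ^ (-g x) := by
        rw [hO.tsum_add (hgs.mul_left _), tsum_mul_left, prSet]
    _ ≤ prSet p {x | T < g x} + (K : ℝ) ^ (-d) := by
        have := mul_le_mul_of_nonneg_left (Real.tsum_le_of_sum_le hg0 hfin) hd0
        linarith

/-- Theorem 2: the infimum `(ε, a)`-achievable second-order overflow threshold equals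
`inf { L | F_a(L) ≤ ε }`, where
`F_a(L) = limsup_n Pr{ (−log_K P_{X^n}(X^n) − n αc a)/(√n · αc) ≥ L }`. -/
theorem second_order_overflow_threshold
    (K : ℕ) (hK : 2 ≤ K)
    (c : Fin K → List (Fin K) → ℝ) (cmax αc : ℝ)
    (hcpos : ∀ (u : Fin K) (s : List (Fin K)), 0 < c u s)
    (hcmax : ∀ (u : Fin K) (s : List (Fin K)), c u s ≤ cmax)
    (hαc : 0 < αc)
    (hcap : ∀ s : List (Fin K), ∑ u : Fin K, (K : ℝ) ^ (-(αc * c u s)) = 1)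
    (𝓧 : Type) [Countable 𝓧]
    (P : (n : ℕ) → (Fin n → 𝓧) → ℝ)
    (hPnn : ∀ n x, 0 ≤ P n x) (hPsum : ∀ n, HasSum (P n) 1)
    (ε : ℝ) (hε0 : 0 ≤ ε) (hε1 : ε < 1)
    (a : ℝ) (ha : 0 < a) :
    sInf {L : ℝ | ∃ φ : (n : ℕ) → (Fin n → 𝓧) → List (Fin K),
        (∀ n x, φ n x ≠ []) ∧
        (∀ n, ∑' x, ENNReal.ofReal ((K : ℝ) ^ (-(αc * strCost c (φ n x)))) ≤ 1) ∧
        Filter.limsup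
          (fun n => prSet (P n)
            {x | strCost c (φ n x) > (n : ℝ) * a + L * Real.sqrt n})
          Filter.atTop ≤ ε}
    = sInf {L : ℝ |
        Filter.limsup
          (fun n : ℕ => prSet (P n)
            {x | (-(Real.logb K (P n x)) - (n : ℝ) * αc * a) / (Real.sqrt n * αc) ≥ L})
          Filter.atTop ≤ ε} := by
  have hK1 : (1 : ℝ) < K := by exact_mod_cast hK
  have hsqrt : Filter.Tendsto (fun n : ℕ => Real.sqrt n) Filter.atTop Filter.atTop :=
    Real.tendsto_sqrt_atTop.comp tendsto_natCast_atTop_atTop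
  refine sInf_eq_of_forall_add_mem ?_ ?_
  · rintro L ⟨φ, -, hkraft, hL⟩ γ hγ
    refine limsup_le_of_eventually_le_add
      (w := fun n : ℕ => (K : ℝ) ^ (-(γ * αc * Real.sqrt n)))
      (fun n => prSet_le_one (hPnn n) (hPsum n) _) (fun n => prSet_nonneg (hPnn n) _) ?_ ?_ hL
    · exact (tendsto_rpow_atBot_of_base_gt_one _ hK1).comp
        (Filter.tendsto_neg_atTop_atBot.comp (hsqrt.const_mul_atTop (mul_pos hγ hαc)))
    · filter_upwards [hsqrt.eventually_gt_atTop 0] with n hn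
      have h := prSet_selfInformation_le hK (hPnn n) (hPsum n).summable (hkraft n)
        (αc * (n * a + L * Real.sqrt n)) (γ * αc * Real.sqrt n)
      refine le_trans (prSet_mono (hPnn n) (hPsum n).summable fun x hx _ => ?_)
        (h.trans (add_le_add_left (prSet_mono (hPnn n) (hPsum n).summable fun x hx _ => ?_) _))
      · have hx' := (le_div_iff₀ (mul_pos hn hαc)).1 hx
        rw [Set.mem_ofPred_eq]
        linarith
      · exact lt_of_mul_lt_mul_left hx hαc.le
  · intro L hL γ hγ
    choose φ hne hkraft hφ using fun n =>
      exists_encoder hK hcmax hαc hcap (hPnn n) (hPsum n)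
    refine ⟨φ, hne, hkraft, limsup_le_of_eventually_le_add (w := fun _ => 0)
      (fun n => prSet_le_one (hPnn n) (hPsum n) _) (fun n => prSet_nonneg (hPnn n) _)
      tendsto_const_nhds ?_ hL⟩
    filter_upwards [hsqrt.eventually_gt_atTop 0,
      (hsqrt.const_mul_atTop (mul_pos hγ hαc)).eventually_ge_atTop
        (Real.logb K 2 + αc * cmax)] with n hn hn'
    rw [add_zero]
    refine prSet_mono (hPnn n) (hPsum n).summable fun x hx hpos => ?_
    refine (le_div_iff₀ (mul_pos hn hαc)).2 ?_
    have h1 := hφ n x hpos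
    have h2 := mul_lt_mul_of_pos_left hx hαc
    linarith
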